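/- Let k be a field of characteristic zero, let A be a commutative k-algebra with ML(A) = k (the image of k in A), and let B be a commutative k-algebra that is an integral domain generated as a k-algebra by its units, such that A ⊗_k B is an integral domain. Then ML(A ⊗_k B) equals the image of B under the canonical inclusion B → A ⊗_k B, b ↦ 1 ⊗ b. -/

import Mathlib

/-- A derivation `D` is locally nilpotent if for every `a` some positive iterate of `D`
kills `a`. -/
def Derivation.IsLocallyNilpotent {k A : Type*} [CommRing k] [CommRing A] [Algebra k A]
    (D : Derivation k A A) : Prop :=
  ∀ a : A, ∃ n : ℕ, 0 < n ∧ (⇑D)^[n] a = 0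

/-- The kernel of a derivation `D : A → A`, as a `k`-subalgebra of `A`. -/
def Derivation.kerSubalgebra {k A : Type*} [CommRing k] [CommRing A] [Algebra k A]
    (D : Derivation k A A) : Subalgebra k A where
  carrier := {a : A | D a = 0}
  add_mem' := by
    intro a b ha hb
    simp only [Set.mem_setOf_eq] at *
    rw [map_add, ha, hb, add_zero]
  mul_mem' := by
    intro a b ha hb
    simp only [Set.mem_setOf_eq] at *
    rw [Derivation.leibniz, ha, hb, smul_zero, smul_zero, add_zero]
  algebraMap_mem' := fun r => by
    simp only [Set.mem_setOf_eq, Derivation.map_algebraMap]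

/-- The Makar-Limanov invariant of a commutative `k`-algebra `A`: the intersection of the
kernels of all locally nilpotent `k`-derivations of `A`. -/
def MakarLimanov (k A : Type*) [CommRing k] [CommRing A] [Algebra k A] : Subalgebra k A :=
  ⨅ D : {D : Derivation k A A // D.IsLocallyNilpotent}, (D : Derivation k A A).kerSubalgebra

theorem mem_makarLimanov_iff {k A : Type*} [CommRing k] [CommRing A] [Algebra k A] {a : A} :
    a ∈ MakarLimanov k A ↔ ∀ D : Derivation k A A, D.IsLocallyNilpotent → D a = 0 := by
  simp only [MakarLimanov, Algebra.mem_iInf, Subtype.forall]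
  exact Iff.rfl

namespace Derivation

open Finset in
theorem iterate_mul {k A : Type*} [CommRing k] [CommRing A] [Algebra k A]
    (D : Derivation k A A) (n : ℕ) (a b : A) :
    D^[n] (a * b) = ∑ ij ∈ antidiagonal n, n.choose ij.1 • (D^[ij.1] a * D^[ij.2] b) := by
  induction n with
  | zero => simp
  | succ n ih =>
    rw [sum_antidiagonal_choose_succ_nsmul (M := A) (fun i j => D^[i] a * D^[j] b) n]
    simp only [Function.iterate_succ_apply', ih, map_sum, map_nsmul, leibniz, smul_add,
      sum_add_distrib, smul_eq_mul]
    congr 1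
    refine sum_congr rfl fun ij hij => ?_
    rw [n.choose_symm_of_eq_add (mem_antidiagonal.1 hij).symm, mul_comm]

namespace IsLocallyNilpotent

theorem exists_iterate_ne_zero {k A : Type*} [CommRing k] [CommRing A] [Algebra k A]
    {D : Derivation k A A} (hD : D.IsLocallyNilpotent) {a : A} (ha : a ≠ 0) :
    ∃ m : ℕ, D^[m] a ≠ 0 ∧ ∀ i, m < i → D^[i] a = 0 := by
  classical
  obtain ⟨n, -, hn⟩ := hD a
  have hex : ∃ n, D^[n] a = 0 := ⟨n, hn⟩
  have hpos : Nat.find hex ≠ 0 := fun h => ha (by simpa [h] using Nat.find_spec hex)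
  refine ⟨Nat.find hex - 1, Nat.find_min hex (by lia), fun i hi => ?_⟩
  obtain ⟨j, rfl⟩ : ∃ j, i = j + Nat.find hex := ⟨i - Nat.find hex, by lia⟩
  rw [Function.iterate_add_apply, Nat.find_spec hex, iterate_map_zero]

open Finset in
/-- In characteristic zero, units of a domain are killed by locally nilpotent derivations. -/
theorem apply_eq_zero_of_isUnit {k A : Type*} [CommRing k] [CommRing A] [IsDomain A] [CharZero A]
    [Algebra k A] {D : Derivation k A A} (hD : D.IsLocallyNilpotent) {u : A} (hu : IsUnit u) :
    D u = 0 := by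
  obtain ⟨v, huv⟩ := hu.exists_right_inv
  obtain ⟨m, hm, hm'⟩ := hD.exists_iterate_ne_zero (left_ne_zero_of_mul_eq_one huv)
  obtain ⟨n, hn, hn'⟩ := hD.exists_iterate_ne_zero (right_ne_zero_of_mul_eq_one huv)
  have key : D^[m + n] (u * v) = (m + n).choose m • (D^[m] u * D^[n] v) := by
    rw [iterate_mul, sum_eq_single (m, n)]
    · rintro ⟨i, j⟩ hij hne
      rw [HasAntidiagonal.mem_antidiagonal] at hij
      rcases lt_trichotomy i m with h | h | h
      · simp [hn' j (by lia)]
      · exact (hne (by ext <;> simp <;> lia)).elim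
      · simp [hm' i h]
    · simp
  have hne : D^[m + n] (1 : A) ≠ 0 := by
    rw [← huv, key]
    exact smul_ne_zero (Nat.choose_pos (Nat.le_add_right m n)).ne' (mul_ne_zero hm hn)
  have hzero : m + n = 0 := by
    by_contra h
    obtain ⟨l, hl⟩ := Nat.exists_eq_succ_of_ne_zero h
    exact hne (by rw [hl, Function.iterate_succ_apply, map_one_eq_zero, iterate_map_zero])
  exact hm' 1 (by lia)

end IsLocallyNilpotent

open TensorProduct

/-- The derivation `D ⊗ id` of `A ⊗[k] B` induced by a derivation `D` of `A`. -/
noncomputable def rTensor {k A : Type*} (B : Type*) [CommRing k] [CommRing A] [Algebra k A]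
    [CommRing B] [Algebra k B] (D : Derivation k A A) : Derivation k (A ⊗[k] B) (A ⊗[k] B) :=
  .mk' (D.toLinearMap.rTensor B) fun x y => by
    induction x with
    | zero => simp
    | add x₁ x₂ h₁ h₂ => simp only [add_mul, map_add, h₁, h₂, smul_eq_mul, mul_add]; ring
    | tmul a b =>
      induction y with
      | zero => simp
      | add y₁ y₂ h₁ h₂ => simp only [add_mul, map_add, h₁, h₂, smul_eq_mul, mul_add]; ring
      | tmul c d => simp [add_tmul, mul_comm d b]

@[simp]
theorem rTensor_tmul {k A B : Type*} [CommRing k] [CommRing A] [Algebra k A]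
    [CommRing B] [Algebra k B] (D : Derivation k A A) (a : A) (b : B) :
    D.rTensor B (a ⊗ₜ b) = D a ⊗ₜ b :=
  rfl

theorem IsLocallyNilpotent.rTensor {k A B : Type*} [CommRing k] [CommRing A] [Algebra k A]
    [CommRing B] [Algebra k B] {D : Derivation k A A} (hD : D.IsLocallyNilpotent) :
    (D.rTensor B).IsLocallyNilpotent := fun x => by
  induction x with
  | zero => exact ⟨1, one_pos, by simp⟩
  | add x y hx hy =>
    obtain ⟨m, hm, hx⟩ := hx
    obtain ⟨n, -, hy⟩ := hy
    refine ⟨m + n, by lia, ?_⟩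
    rw [iterate_map_add, Function.iterate_add_apply _ m n y, hy, add_comm m n,
      Function.iterate_add_apply, hx, iterate_map_zero, iterate_map_zero, add_zero]
  | tmul a b =>
    obtain ⟨n, hn, ha⟩ := hD a
    have hiter (n : ℕ) : (D.rTensor B)^[n] (a ⊗ₜ b) = D^[n] a ⊗ₜ b := by
      induction n with
      | zero => rfl
      | succ n ih => simp only [Function.iterate_succ_apply', ih, rTensor_tmul]
    exact ⟨n, hn, by rw [hiter, ha, zero_tmul]⟩

theorem equivFinsuppOfBasisRight_rTensor {k A B ι : Type*} [CommRing k] [CommRing A]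
    [Algebra k A] [CommRing B] [Algebra k B] [DecidableEq ι] (b : Module.Basis ι k B)
    (D : Derivation k A A) (x : A ⊗[k] B) (i : ι) :
    TensorProduct.equivFinsuppOfBasisRight b (D.rTensor B x) i =
      D (TensorProduct.equivFinsuppOfBasisRight b x i) := by
  induction x with
  | zero => simp
  | add x y hx hy => simp [hx, hy]
  | tmul a c => simp

end Derivation

open TensorProduct in
theorem makarLimanov_tensor_le_range_includeRight {k A B : Type*} [Field k] [CommRing A]
    [Algebra k A] [CommRing B] [Algebra k B] (hA : MakarLimanov k A = ⊥) :
    MakarLimanov k (A ⊗[k] B) ≤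
      (Algebra.TensorProduct.includeRight : B →ₐ[k] A ⊗[k] B).range := by
  classical
  intro x hx
  rw [mem_makarLimanov_iff] at hx
  let b := Module.Basis.ofVectorSpace k B
  rw [← (TensorProduct.equivFinsuppOfBasisRight b).symm_apply_apply x,
    TensorProduct.equivFinsuppOfBasisRight_symm_apply]
  refine Subalgebra.sum_mem _ fun i _ => ?_
  have hcoeff : TensorProduct.equivFinsuppOfBasisRight b x i ∈ MakarLimanov k A :=
    mem_makarLimanov_iff.2 fun D hD => by
      rw [← D.equivFinsuppOfBasisRight_rTensor, hx _ hD.rTensor, map_zero, Finsupp.zero_apply]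
  rw [hA, Algebra.mem_bot] at hcoeff
  obtain ⟨c, hc⟩ := hcoeff
  refine ⟨c • b i, ?_⟩
  rw [← hc, Algebra.algebraMap_eq_smul_one]
  exact (smul_tmul c 1 (b i)).symm

theorem range_le_makarLimanov_of_adjoin_isUnit {k B R : Type*} [CommRing k] [CommRing B]
    [Algebra k B] [CommRing R] [IsDomain R] [CharZero R] [Algebra k R]
    (hB : Algebra.adjoin k {b : B | IsUnit b} = ⊤) (f : B →ₐ[k] R) :
    f.range ≤ MakarLimanov k R := by
  rw [← Algebra.map_top, ← hB, AlgHom.map_adjoin, Algebra.adjoin_le_iff]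
  rintro _ ⟨u, hu, rfl⟩
  exact mem_makarLimanov_iff.2 fun D hD => hD.apply_eq_zero_of_isUnit (hu.map f)

open TensorProduct in
theorem makarLimanov_tensor_toral (k A B : Type*) [Field k] [CharZero k]
    [CommRing A] [Algebra k A] [CommRing B] [IsDomain B] [Algebra k B]
    [IsDomain (A ⊗[k] B)]
    (hA : MakarLimanov k A = ⊥)
    (hB : Algebra.adjoin k {b : B | IsUnit b} = ⊤) :
    MakarLimanov k (A ⊗[k] B) =
      (Algebra.TensorProduct.includeRight : B →ₐ[k] A ⊗[k] B).range := by
  have := charZero_of_injective_algebraMap (FaithfulSMul.algebraMap_injective k (A ⊗[k] B))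
  exact (makarLimanov_tensor_le_range_includeRight hA).antisymm
    (range_le_makarLimanov_of_adjoin_isUnit hB _)
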